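/- Fix an integer r ≥ 1 and let s, B, b_0,…,b_{2r+1}, g_k be as defined. Then g_0 > 2^(2^(2r+1)), and if moreover r ≥ 2 then g_1 > 2^(2^(2r)). (In the paper's notation: m_n > 2^(2^n) for every dimension n > 2, where m_{2r+1} = g_0 and m_{2r} = g_1.) -/

import Mathlib

/-- Sylvester's sequence: `s 0 = 2`, `s (j+1) = s j * (s j − 1) + 1`;
it begins 2, 3, 7, 43, 1807, …. -/
def sylv : ℕ → ℕ
  | 0 => 2
  | n + 1 => sylv n * (sylv n - 1) + 1

/-- The alternating sum `B(x₁,…,x_k) = ∑_{j=0}^{k} (−1)^{k−j} x₁⋯x_j`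
(the empty product being 1), characterized by `B [] = 1` and
`B (x :: xs) = x * B xs + (−1)^(length (x :: xs))`. -/
def Bsum : List ℤ → ℤ
  | [] => 1
  | x :: xs => x * Bsum xs + (-1) ^ (xs.length + 1)

/-- `Zl r t` is the list of length `2t` formed by concatenating the pairs
`(b_{r+u}, b_{r+1−u})` for `u = 1, …, t`, where `b` are the exponents
defined inductively together with this list. -/
def Zl (r : ℕ) : ℕ → List ℤ
  | 0 => []
  | t + 1 => Zl r t ++ [1 + ((sylv (r - t) : ℤ) - 1) ^ 2 * Bsum (Zl r t), (sylv (r - t) : ℤ)]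

/-- The exponents `b_0, …, b_{2r+1}`: `b_j = s_j` for `j ≤ r`, and
`b_{r+i} = 1 + (b_{r+1−i} − 1)² · B(Z_{i−1})` for `1 ≤ i ≤ r+1`
(here, for `j = r + i`, one has `b_{r+1−i} = s_{2r+1−j}`). -/
def bexp (r j : ℕ) : ℤ :=
  if j ≤ r then (sylv j : ℤ)
  else 1 + ((sylv (2 * r + 1 - j) : ℤ) - 1) ^ 2 * Bsum (Zl r (j - r - 1))

/-- The list `L_k = (b_{r+1}, b_r, b_{r+2}, b_{r−1}, …, b_{2r+1−k}, b_k)`,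
formed by concatenating the pairs `(b_{r+t}, b_{r+1−t})` for `t = 1, …, r+1−k`. -/
def Lk (r k : ℕ) : List ℤ := Zl r (r + 1 - k)

/-- `t_k := B(L_k)`. -/
def tB (r k : ℕ) : ℤ := Bsum (Lk r k)

/-- `g_k := B(reverse of L_k)`. -/
def gB (r k : ℕ) : ℤ := Bsum (Lk r k).reverse

/-- `T_k`: the alternating sum of `B` over the suffixes of `L_k`
(the full list with sign `+`, the empty suffix contributing `+1`). -/
def TB (r k : ℕ) : ℤ :=
  ∑ m ∈ Finset.range ((Lk r k).length + 1), (-1) ^ m * Bsum ((Lk r k).drop m)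

/-- `w_k := (s_k − 1)·T_k − 1`. -/
def wB (r k : ℕ) : ℤ := ((sylv k : ℤ) - 1) * TB r k - 1

theorem Bsum_append_singleton (l : List ℤ) (x : ℤ) :
    Bsum (l ++ [x]) = l.prod * x - Bsum l := by
  induction l with
  | nil => simp [Bsum]; ring
  | cons y l ih =>
    simp only [List.cons_append, Bsum, ih, List.prod_cons, List.length_append, List.length_cons,
      List.length_nil]
    ring

theorem length_Zl (r t : ℕ) : (Zl r t).length = 2 * t := by
  induction t with
  | zero => rfl
  | succ t ih => simp [Zl, ih]; ring

theorem prod_Zl_succ (r t : ℕ) :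
    (Zl r (t + 1)).prod =
      (Zl r t).prod * (1 + ((sylv (r - t) : ℤ) - 1) ^ 2 * Bsum (Zl r t)) * sylv (r - t) := by
  simp [Zl, mul_assoc]

theorem Bsum_Zl_succ (r t : ℕ) :
    Bsum (Zl r (t + 1)) =
      (Zl r t).prod * (1 + ((sylv (r - t) : ℤ) - 1) ^ 2 * Bsum (Zl r t)) * (sylv (r - t) - 1)
        + Bsum (Zl r t) := by
  have h (l : List ℤ) (x y : ℤ) : l ++ [x, y] = (l ++ [x]) ++ [y] := by simp
  rw [Zl, h, Bsum_append_singleton, Bsum_append_singleton, List.prod_append, List.prod_singleton]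
  ring

theorem Bsum_reverse_Zl_succ (r t : ℕ) :
    Bsum (Zl r (t + 1)).reverse =
      sylv (r - t) * (1 + ((sylv (r - t) : ℤ) - 1) ^ 2 * Bsum (Zl r t)) * Bsum (Zl r t).reverse
        - sylv (r - t) + 1 := by
  simp only [Zl, List.reverse_append, List.reverse_cons, List.reverse_nil, List.nil_append,
    List.cons_append, Bsum, List.length_cons, List.length_reverse, length_Zl, pow_succ, pow_mul]
  norm_num
  ring

theorem two_le_sylv (n : ℕ) : 2 ≤ sylv n := by
  induction n with
  | zero => rfl
  | succ n ih =>
    have : 1 ≤ sylv n - 1 := by omega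
    rw [sylv]
    nlinarith

theorem sylv_succ_sub_one (n : ℕ) :
    (sylv (n + 1) : ℤ) - 1 = sylv n * (sylv n - 1) := by
  have := two_le_sylv n
  rw [sylv]
  push_cast [Nat.cast_sub (show 1 ≤ sylv n by omega)]
  ring

theorem two_pow_two_pow_le_sylv_succ (n : ℕ) : (2 : ℤ) ^ 2 ^ n ≤ sylv (n + 1) - 1 := by
  induction n with
  | zero => norm_num [sylv]
  | succ n ih =>
    have h : (0 : ℤ) < 2 ^ 2 ^ n := by positivity
    rw [sylv_succ_sub_one, pow_succ 2 n, pow_mul]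
    nlinarith

/-- The solution of `D (t + 1) = (s_{r-t} - 1)³ (D t)²`, `D 0 = 1`, a common lower bound for the
product of `Zl r t` and for `Bsum` of `Zl r t` and of its reverse. -/
def ZlLowerBound (r : ℕ) : ℕ → ℤ
  | 0 => 1
  | t + 1 => ((sylv (r - t) : ℤ) - 1) ^ 3 * ZlLowerBound r t ^ 2

theorem ZlLowerBound_le (r t : ℕ) :
    1 ≤ ZlLowerBound r t ∧ ZlLowerBound r t ≤ (Zl r t).prod ∧
      ZlLowerBound r t ≤ Bsum (Zl r t) ∧ ZlLowerBound r t ≤ Bsum (Zl r t).reverse := by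
  induction t with
  | zero => simp [ZlLowerBound, Zl, Bsum]
  | succ t ih =>
    obtain ⟨h₁, hP, hK, hG⟩ := ih
    rw [prod_Zl_succ, Bsum_Zl_succ, Bsum_reverse_Zl_succ, ZlLowerBound]
    obtain ⟨u, hu⟩ : ∃ u : ℤ, u = sylv (r - t) - 1 := ⟨_, rfl⟩
    have hs : (sylv (r - t) : ℤ) = u + 1 := by omega
    have hu₁ : 1 ≤ u := by
      have := two_le_sylv (r - t)
      omega
    rw [hs, add_sub_cancel_right]
    generalize ZlLowerBound r t = D at *
    generalize (Zl r t).prod = P at *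
    generalize Bsum (Zl r t) = K at *
    generalize Bsum (Zl r t).reverse = G at *
    have hu2 : u ≤ u ^ 2 := by nlinarith
    have hc : u ^ 2 * D ≤ 1 + u ^ 2 * K := by nlinarith
    have hcu : u ≤ 1 + u ^ 2 * K := by nlinarith
    generalize 1 + u ^ 2 * K = c at *
    have hD2 : 0 ≤ u ^ 2 * D := by positivity
    have hcP : u ^ 2 * D * D ≤ c * P := mul_le_mul hc hP (by omega) (by omega)
    have hcG : u ^ 2 * D * D ≤ c * G := mul_le_mul hc hG (by omega) (by omega)
    have hcuG : u ≤ c * G := by nlinarith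
    have hcP0 : 0 ≤ c * P := by nlinarith
    refine ⟨?_, ?_, ?_, ?_⟩
    · exact one_le_mul_of_one_le_of_one_le (one_le_pow₀ hu₁) (one_le_pow₀ h₁)
    · nlinarith
    · nlinarith
    · nlinarith

theorem le_ZlLowerBound_mul (m t d : ℕ) (h : t + d = m) :
    ((2 : ℤ) ^ 2 ^ (d + 2)) ^ 4 ^ t ≤ ZlLowerBound (m + 2) t * 2 ^ 2 ^ (d + 2) := by
  induction t generalizing d with
  | zero => simp [ZlLowerBound]
  | succ t ih =>
    have ih := ih (d + 1) (by omega)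
    have hs := two_pow_two_pow_le_sylv_succ (d + 2)
    rw [ZlLowerBound, show m + 2 - t = d + 2 + 1 by omega]
    have hQ : (2 : ℤ) ^ 2 ^ (d + 1 + 2) = (2 ^ 2 ^ (d + 2)) ^ 2 := by
      rw [← pow_mul, ← pow_succ]
    rw [hQ] at ih
    have hQ0 : (0 : ℤ) < 2 ^ 2 ^ (d + 2) := by positivity
    generalize (2 : ℤ) ^ 2 ^ (d + 2) = Q at *
    calc Q ^ 4 ^ (t + 1) = ((Q ^ 2) ^ 4 ^ t) ^ 2 := by
          rw [← pow_mul, ← pow_mul]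
          ring_nf
      _ ≤ (ZlLowerBound (m + 2) t * Q ^ 2) ^ 2 := by gcongr
      _ = Q ^ 3 * ZlLowerBound (m + 2) t ^ 2 * Q := by ring
      _ ≤ _ := by gcongr

theorem two_pow_lt_ZlLowerBound {r : ℕ} (hr : 2 ≤ r) :
    (2 : ℤ) ^ 2 ^ (2 * r) < ZlLowerBound r r := by
  obtain ⟨m, rfl⟩ := Nat.exists_eq_add_of_le' hr
  have h := le_ZlLowerBound_mul m m 0 rfl
  have h₁ := (ZlLowerBound_le (m + 2) m).1
  rw [ZlLowerBound, ZlLowerBound, show m + 2 - (m + 1) = 1 by omega,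
    show m + 2 - m = 2 by omega]
  norm_num [sylv] at h ⊢
  calc (2 : ℤ) ^ 2 ^ (2 * (m + 2)) = (16 ^ 4 ^ m) ^ 4 := by
        rw [show (16 : ℤ) = 2 ^ 4 by norm_num, ← pow_mul, ← pow_mul, pow_mul 2 2]
        ring_nf
    _ ≤ (ZlLowerBound (m + 2) m * 16) ^ 4 := by gcongr
    _ < _ := by nlinarith [pow_pos (show 0 < ZlLowerBound (m + 2) m by omega) 4]

/-- Doubly exponential growth of `m_n`: `m_{2r+1} = g_0 > 2^(2^(2r+1))` for `r ≥ 1`,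
and `m_{2r} = g_1 > 2^(2^(2r))` for `r ≥ 2`. -/
theorem m_doubly_exponential (r : ℕ) (hr : 1 ≤ r) :
    (2 : ℤ) ^ 2 ^ (2 * r + 1) < gB r 0 ∧ (2 ≤ r → (2 : ℤ) ^ 2 ^ (2 * r) < gB r 1) := by
  refine ⟨?_, fun h => (two_pow_lt_ZlLowerBound h).trans_le (ZlLowerBound_le r r).2.2.2⟩
  obtain rfl | h := hr.eq_or_lt
  · norm_num [gB, Lk, Zl, sylv, Bsum]
  · refine lt_of_lt_of_le ?_ (ZlLowerBound_le r (r + 1)).2.2.2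
    rw [ZlLowerBound, pow_succ 2 (2 * r), pow_mul]
    norm_num [sylv]
    have := two_pow_lt_ZlLowerBound h
    gcongr
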